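/- Let n ≥ 2 and let u : ℝⁿ → ℝ be a smooth convex function with |∇u(x)| < 1 for all x ∈ ℝⁿ, satisfying det D²u(x) = ψ(x) · (1 − |∇u(x)|²)^{(n+2)/2} for all x ∈ ℝⁿ, where ψ : ℝⁿ → ℝ is a function satisfying 0 < ψ₁ ≤ ψ(x) ≤ ψ₂ for all x, for some constants ψ₁, ψ₂. Then: (i) for every x ∈ ℝⁿ the finite limit V_u(x) := lim_{r→+∞} u(r·x)/r exists; and (ii) V_u satisfies the null condition: for every x ∈ ℝⁿ there exists y ∈ ℝⁿ with y ≠ x and |V_u(x) − V_u(y)| = |x − y|. -/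

import Mathlib

open Real Filter

/-- The blowdown at infinity of a convex `1`-Lipschitz function exists. -/
theorem ConvexOn.exists_tendsto_blowdown {E : Type*} [NormedAddCommGroup E]
    [NormedSpace ℝ E] {u : E → ℝ} (hconv : ConvexOn ℝ Set.univ u)
    (hlip : ∀ a b, u a - u b ≤ ‖a - b‖) (x : E) :
    ∃ L : ℝ, Tendsto (fun r : ℝ => u (r • x) / r) atTop (nhds L) := by
  have hray : ConvexOn ℝ Set.univ (fun r : ℝ => u (r • x)) :=
    hconv.comp_linearMap (LinearMap.toSpanSingleton ℝ E x)
  set q : ℝ → ℝ := fun r => slope (fun r : ℝ => u (r • x)) 0 (max r 1) with hq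
  have hmono : Monotone q := by
    intro r s hrs
    have hpos : ∀ t : ℝ, max t 1 ≠ 0 := fun t => (zero_lt_one.trans_le (le_max_right t 1)).ne'
    exact hray.slope_mono (Set.mem_univ 0) ⟨Set.mem_univ _, hpos r⟩ ⟨Set.mem_univ _, hpos s⟩
      (max_le_max_right 1 hrs)
  have hbdd : BddAbove (Set.range q) := by
    refine ⟨‖x‖, ?_⟩
    rintro _ ⟨r, rfl⟩
    have hr : 0 < max r 1 := zero_lt_one.trans_le (le_max_right r 1)
    have := hlip (max r 1 • x) ((0 : ℝ) • x)
    rw [← sub_smul, norm_smul, sub_zero, Real.norm_of_nonneg hr.le] at this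
    simp only [hq, slope_def_field, sub_zero]
    rwa [div_le_iff₀ hr, mul_comm]
  refine ⟨_, ((tendsto_atTop_ciSup hmono hbdd).add
    (tendsto_const_nhds (x := u 0).div_atTop tendsto_id)).congr' ?_⟩
  filter_upwards [eventually_ge_atTop 1] with r hr
  simp only [hq, slope_def_field, max_eq_left hr, sub_zero, zero_smul, id]
  ring

section Gradient

variable {E : Type*} [NormedAddCommGroup E] [InnerProductSpace ℝ E] [CompleteSpace E] {u : E → ℝ}

/-- A differentiable convex function lies above its tangent planes. -/
theorem ConvexOn.add_inner_gradient_le (hconv : ConvexOn ℝ Set.univ u) {a : E}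
    (hd : DifferentiableAt ℝ u a) (b : E) :
    u a + inner ℝ (gradient u a) (b - a) ≤ u b := by
  have hline : ConvexOn ℝ Set.univ (fun t : ℝ => u (AffineMap.lineMap a b t)) :=
    hconv.comp_affineMap (AffineMap.lineMap a b)
  have hderiv : HasDerivAt (fun t : ℝ => u (AffineMap.lineMap a b t))
      (inner ℝ (gradient u a) (b - a)) 0 := by
    have hu : HasFDerivAt u (InnerProductSpace.toDual ℝ E (gradient u a))
        (AffineMap.lineMap a b (0 : ℝ)) := by
      simpa using hd.hasGradientAt.hasFDerivAt
    exact hu.comp_hasDerivAt (0 : ℝ) AffineMap.hasDerivAt_lineMap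
  have hslope := hline.le_slope_of_hasDerivAt (Set.mem_univ 0) (Set.mem_univ 1) zero_lt_one hderiv
  simp only [slope_def_field, AffineMap.lineMap_apply_one, AffineMap.lineMap_apply_zero, sub_zero,
    div_one] at hslope
  linarith

/-- A differentiable function has at most one supporting plane at a point. -/
theorem gradient_eq_of_forall_add_inner_le {a p : E} (hd : DifferentiableAt ℝ u a)
    (h : ∀ z, u a + inner ℝ p (z - a) ≤ u z) : gradient u a = p := by
  have hmin : IsLocalMin (fun z => u z - innerSL ℝ p z) a := by
    refine Eventually.of_forall fun z => ?_
    have := h z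
    simp only [inner_sub_right, innerSL_apply_apply] at this ⊢
    linarith
  have hzero := hmin.hasFDerivAt_eq_zero
    (hd.hasGradientAt.hasFDerivAt.sub (innerSL ℝ p).hasFDerivAt)
  refine ext_inner_right ℝ fun v => ?_
  have := DFunLike.congr_fun hzero v
  simpa [sub_eq_zero] using this

/-- The gradient of a convex function is injective if its derivative is everywhere injective. -/
theorem ConvexOn.gradient_injective (hconv : ConvexOn ℝ Set.univ u) (hd : Differentiable ℝ u)
    (hd' : Differentiable ℝ (gradient u))
    (hinj : ∀ x, Function.Injective (fderiv ℝ (gradient u) x)) :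
    Function.Injective (gradient u) := by
  intro a b hab
  have hconst : ∀ t ∈ Set.Icc (0 : ℝ) 1,
      gradient u (AffineMap.lineMap a b t) = gradient u a := by
    intro t ht
    refine gradient_eq_of_forall_add_inner_le (hd _) fun z => ?_
    have ha := hconv.add_inner_gradient_le (hd a) z
    have hb := hconv.add_inner_gradient_le (hd b) z
    have hc := hconv.2 (Set.mem_univ a) (Set.mem_univ b) (sub_nonneg.2 ht.2) ht.1
      (sub_add_cancel 1 t)
    rw [← hab] at hb
    rw [AffineMap.lineMap_apply_module]
    simp only [inner_sub_right, inner_add_right, inner_smul_right, smul_eq_mul] at *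
    nlinarith [mul_le_mul_of_nonneg_left ha (sub_nonneg.2 ht.2),
      mul_le_mul_of_nonneg_left hb ht.1]
  have hderiv : HasDerivAt (fun t : ℝ => gradient u (AffineMap.lineMap a b t))
      (fderiv ℝ (gradient u) (AffineMap.lineMap a b (1 / 2 : ℝ)) (b - a)) (1 / 2) :=
    (hd' _).hasFDerivAt.comp_hasDerivAt _ AffineMap.hasDerivAt_lineMap
  have hderiv' : HasDerivAt (fun t : ℝ => gradient u (AffineMap.lineMap a b t)) 0 (1 / 2) := by
    refine (hasDerivAt_const (1 / 2 : ℝ) (gradient u a)).congr_of_eventuallyEq ?_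
    filter_upwards [Icc_mem_nhds (by norm_num : (0 : ℝ) < 1 / 2) (by norm_num : (1 / 2 : ℝ) < 1)]
      with t ht using hconst t ht
  have hba : b - a = 0 := hinj _ ((hderiv.unique hderiv').trans (map_zero _).symm)
  exact (sub_eq_zero.1 hba).symm

/-- A convex function with gradients in the unit ball is `1`-Lipschitz. -/
theorem ConvexOn.sub_le_norm_sub (hconv : ConvexOn ℝ Set.univ u) (hd : Differentiable ℝ u)
    (hsp : ∀ x, ‖gradient u x‖ < 1) (a b : E) : u a - u b ≤ ‖a - b‖ := by
  have h₁ := hconv.add_inner_gradient_le (hd a) b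
  have h₂ := real_inner_le_norm (gradient u a) (a - b)
  have h₃ : ‖gradient u a‖ * ‖a - b‖ ≤ ‖a - b‖ :=
    mul_le_of_le_one_left (norm_nonneg _) (hsp a).le
  simp only [inner_sub_right] at h₁ h₂
  linarith

end Gradient

section FiniteDimensional

variable {E : Type*} [NormedAddCommGroup E] [InnerProductSpace ℝ E] [FiniteDimensional ℝ E]
  {u : E → ℝ}

/-- If the Jacobian of an injective map into the unit ball is at least `k > 0` on a ball of
radius `R ≥ 1`, then `k * R ≤ 1`. -/
theorem mul_radius_le_one_of_le_abs_det_fderiv [Nontrivial E] {f : E → E}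
    (hf : Differentiable ℝ f) (hinj : Function.Injective f) (hball : ∀ x, ‖f x‖ < 1)
    {k R : ℝ} (hk : 0 < k) (hR : 1 ≤ R) {y : E}
    (hdet : ∀ z ∈ Metric.ball y R, k ≤ |(fderiv ℝ f z).det|) : k * R ≤ 1 := by
  borelize E
  let μ : MeasureTheory.Measure E := MeasureTheory.volume
  have himage := MeasureTheory.lintegral_abs_det_fderiv_eq_addHaar_image μ
    (Metric.isOpen_ball (x := y) (ε := R)).measurableSet
    (fun z _ => (hf z).hasFDerivAt.hasFDerivWithinAt) hinj.injOn
  have hlower : ENNReal.ofReal k * μ (Metric.ball y R) ≤ μ (Metric.ball 0 1) := by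
    calc ENNReal.ofReal k * μ (Metric.ball y R)
        = ∫⁻ _ in Metric.ball y R, ENNReal.ofReal k ∂μ := by simp
      _ ≤ ∫⁻ z in Metric.ball y R, ENNReal.ofReal |(fderiv ℝ f z).det| ∂μ :=
          MeasureTheory.setLIntegral_mono' Metric.isOpen_ball.measurableSet
            fun z hz => ENNReal.ofReal_le_ofReal (hdet z hz)
      _ = μ (f '' Metric.ball y R) := himage
      _ ≤ μ (Metric.ball 0 1) := by
          refine MeasureTheory.measure_mono ?_
          rintro _ ⟨z, -, rfl⟩
          simpa using hball z
  have hR₀ : 0 ≤ R := zero_le_one.trans hR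
  have hfinite : μ (Metric.ball 0 1) ≠ ⊤ := MeasureTheory.measure_ball_lt_top.ne
  have hpos : μ (Metric.ball 0 1) ≠ 0 := (Metric.measure_ball_pos μ 0 one_pos).ne'
  rw [MeasureTheory.Measure.addHaar_ball μ y hR₀, ← mul_assoc, ← ENNReal.ofReal_mul hk.le] at hlower
  have hle : ENNReal.ofReal (k * R ^ Module.finrank ℝ E) ≤ 1 := by
    rwa [← one_mul (μ (Metric.ball 0 1)), ← mul_assoc, mul_one,
      ENNReal.mul_le_mul_iff_left hpos hfinite] at hlower
  rw [ENNReal.ofReal_le_one] at hle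
  exact (mul_le_mul_of_nonneg_left (le_self_pow₀ hR Module.finrank_pos.ne') hk.le).trans hle

/-- If in every large ball the gradients of a convex function get arbitrarily close to the unit
sphere, then its blowdown at infinity satisfies the null condition. -/
theorem ConvexOn.null_condition_blowdown (hconv : ConvexOn ℝ Set.univ u)
    (hd : Differentiable ℝ u) (hsp : ∀ x, ‖gradient u x‖ < 1)
    (hlarge : ∀ c < (1 : ℝ), ∃ R₀ : ℝ, ∀ R ≥ R₀, ∀ y, ∃ z ∈ Metric.ball y R, c < ‖gradient u z‖)
    {V : E → ℝ} (hV : ∀ x, Tendsto (fun r : ℝ => u (r • x) / r) atTop (nhds (V x))) (x : E) :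
    ∃ y, y ≠ x ∧ |V x - V y| = ‖x - y‖ := by
  have hlip := hconv.sub_le_norm_sub hd hsp
  have hseq : ∀ k : ℕ, ∃ r : ℝ, ∃ z : E, (k : ℝ) + 1 ≤ r ∧ ‖z - r • x‖ ≤ r * (1 / ((k : ℝ) + 1)) ∧
      1 - 1 / ((k : ℝ) + 1) ≤ ‖gradient u z‖ := by
    intro k
    have hk : (0 : ℝ) < k + 1 := by positivity
    obtain ⟨R₀, hR₀⟩ := hlarge (1 - 1 / ((k : ℝ) + 1)) (by
      have : 0 < 1 / ((k : ℝ) + 1) := by positivity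
      linarith)
    obtain ⟨z, hz, hgrad⟩ := hR₀ (max R₀ 1) (le_max_left _ _) ((((k : ℝ) + 1) * max R₀ 1) • x)
    refine ⟨((k : ℝ) + 1) * max R₀ 1, z, le_mul_of_one_le_right hk.le (le_max_right _ _), ?_,
      hgrad.le⟩
    rw [mem_ball_iff_norm] at hz
    refine hz.le.trans_eq ?_
    field_simp
  choose r z hr hz hgrad using hseq
  have hrpos : ∀ k, 0 < r k := fun k => lt_of_lt_of_le (by positivity) (hr k)
  have hrtop : Tendsto r atTop atTop :=
    tendsto_atTop_mono (fun k => (by linarith [hr k] : (k : ℝ) ≤ r k)) tendsto_natCast_atTop_atTop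
  obtain ⟨p, -, φ, hφ, hp⟩ := (isCompact_closedBall (0 : E) 1).tendsto_subseq
    (x := fun k => gradient u (z k)) (fun k => by simpa using (hsp (z k)).le)
  have hsmall : Tendsto (fun k => 1 / ((φ k : ℝ) + 1)) atTop (nhds 0) :=
    tendsto_one_div_add_atTop_nhds_zero_nat.comp hφ.tendsto_atTop
  have hnorm : ‖p‖ = 1 := by
    refine le_antisymm (le_of_tendsto hp.norm (Eventually.of_forall fun k => (hsp _).le)) ?_
    have h₁ : Tendsto (fun k => 1 - 1 / ((φ k : ℝ) + 1)) atTop (nhds 1) := by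
      simpa using hsmall.const_sub 1
    exact le_of_tendsto_of_tendsto' h₁ hp.norm fun k => hgrad (φ k)
  have hupper : V (x + p) - V x ≤ 1 := by
    refine le_of_tendsto ((hV (x + p)).sub (hV x)) ?_
    filter_upwards [eventually_gt_atTop 0] with s hs
    have := hlip (s • (x + p)) (s • x)
    rw [← smul_sub, add_sub_cancel_left, norm_smul, hnorm, Real.norm_of_nonneg hs.le] at this
    rw [← sub_div, div_le_iff₀ hs]
    linarith
  have hlower : 1 ≤ V (x + p) - V x := by
    have hrφ := hrtop.comp hφ.tendsto_atTop
    have h₁ := ((hV (x + p)).comp hrφ).sub ((hV x).comp hrφ)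
    have h₂ : Tendsto (fun k => inner ℝ (gradient u (z (φ k))) p - 2 * (1 / ((φ k : ℝ) + 1)))
        atTop (nhds 1) := by
      have := (hp.inner (tendsto_const_nhds (x := p))).sub (hsmall.const_mul 2)
      simpa [hnorm] using this
    refine le_of_tendsto_of_tendsto' h₂ h₁ fun k => ?_
    simp only [Function.comp_apply]
    generalize φ k = m
    have htangent := hconv.add_inner_gradient_le (hd (z m)) (r m • (x + p))
    have hlip' := hlip (r m • x) (z m)
    have hinner := real_inner_le_norm (gradient u (z m)) (z m - r m • x)
    have hgrad_le : ‖gradient u (z m)‖ * ‖z m - r m • x‖ ≤ ‖z m - r m • x‖ :=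
      mul_le_of_le_one_left (norm_nonneg _) (hsp _).le
    have hzm := hz m
    rw [norm_sub_rev] at hlip'
    rw [← sub_div, le_div_iff₀ (hrpos m)]
    simp only [smul_add, inner_sub_right, inner_add_right, inner_smul_right] at *
    linarith
  refine ⟨x + p, fun h => ?_, ?_⟩
  · rw [add_eq_left] at h
    simp [h] at hnorm
  · rw [abs_sub_comm, le_antisymm hupper hlower, abs_one, sub_add_cancel_left, norm_neg, hnorm]

end FiniteDimensional

/-- for an entire smooth convex spacelike solution of the prescribed
Gauss curvature equation with curvature pinched between two positive constants,
the blowdown `V_u(x) = lim_{r → +∞} u(r x)/r` exists for every `x`, and it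
satisfies the null condition. Here the dimension is `n + 2 ≥ 2`, and
`det D²u x` is expressed as the determinant of the derivative of the gradient map. -/
theorem stmt_16 (n : ℕ) (u : EuclideanSpace ℝ (Fin (n + 2)) → ℝ)
    (hu : ContDiff ℝ (⊤ : ℕ∞) u) (hconv : ConvexOn ℝ Set.univ u)
    (hsp : ∀ x, ‖gradient u x‖ < 1)
    (ψ : EuclideanSpace ℝ (Fin (n + 2)) → ℝ) (ψ₁ ψ₂ : ℝ) (hψ₁ : 0 < ψ₁)
    (hψ : ∀ x, ψ₁ ≤ ψ x ∧ ψ x ≤ ψ₂)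
    (hMA : ∀ x, (fderiv ℝ (gradient u) x).det
      = ψ x * (1 - ‖gradient u x‖ ^ 2) ^ ((((n : ℝ) + 2) + 2) / 2)) :
    (∀ x, ∃ L : ℝ, Tendsto (fun r : ℝ => u (r • x) / r) atTop (nhds L)) ∧
    (∀ V : EuclideanSpace ℝ (Fin (n + 2)) → ℝ,
      (∀ x, Tendsto (fun r : ℝ => u (r • x) / r) atTop (nhds (V x))) →
      ∀ x, ∃ y, y ≠ x ∧ |V x - V y| = ‖x - y‖) := by
  have hd : Differentiable ℝ u := hu.differentiable (by simp)
  have hd' : Differentiable ℝ (gradient u) :=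
    (InnerProductSpace.toDual ℝ (EuclideanSpace ℝ (Fin (n + 2)))).symm.differentiable.comp
      ((hu.fderiv_right (m := 1) (WithTop.coe_le_coe.2 (le_top : (1 + 1 : ℕ∞) ≤ ⊤))).differentiable
        (by simp))
  have hgap : ∀ x, 0 < 1 - ‖gradient u x‖ ^ 2 := fun x => by
    nlinarith [hsp x, norm_nonneg (gradient u x)]
  have hψpos : ∀ x, 0 < ψ x := fun x => hψ₁.trans_le (hψ x).1
  have hdetpos : ∀ x, 0 < (fderiv ℝ (gradient u) x).det := fun x => by
    rw [hMA]
    exact mul_pos (hψpos x) (Real.rpow_pos_of_pos (hgap x) _)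
  have hinj : Function.Injective (gradient u) :=
    hconv.gradient_injective hd hd' fun x =>
      (LinearMap.equivOfDetNeZero _ (hdetpos x).ne').injective
  refine ⟨hconv.exists_tendsto_blowdown (hconv.sub_le_norm_sub hd hsp), fun V hV x =>
    hconv.null_condition_blowdown hd hsp (fun c hc => ?_) hV x⟩
  set d : ℝ := max c 0
  have hd₀ : 0 ≤ d := le_max_right c 0
  have hd₁ : d < 1 := max_lt hc zero_lt_one
  have hgapd : 0 < 1 - d ^ 2 := by nlinarith
  set k : ℝ := ψ₁ * (1 - d ^ 2) ^ ((((n : ℝ) + 2) + 2) / 2) with hk_def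
  have hk : 0 < k := mul_pos hψ₁ (Real.rpow_pos_of_pos hgapd _)
  refine ⟨max 1 (2 / k), fun R hR y => ?_⟩
  by_contra! hbound
  have hkR : 2 ≤ k * R := by
    rw [← div_le_iff₀' hk]
    exact (le_max_right _ _).trans hR
  have hle : k * R ≤ 1 := by
    refine mul_radius_le_one_of_le_abs_det_fderiv hd' hinj hsp hk ((le_max_left _ _).trans hR)
      (y := y) fun z hz => ?_
    rw [abs_of_pos (hdetpos z), hMA, hk_def]
    have hgrad : ‖gradient u z‖ ≤ d := (hbound z hz).trans (le_max_left c 0)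
    have := hψpos z
    gcongr
    exact (hψ z).1
  linarith
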